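/- Let A be the central arrangement defined by pairwise non-proportional nonzero linear forms l_1,…,l_p (A is NOT assumed free). Then there exists N ∈ ℕ such that the polynomial b_me(s_1,…,s_p) = ∏_{X ∈ L'(A)} ∏_{j=0}^{N} ( (∑_{i ∈ J(X)} s_i) + r(X) + j ) belongs to the Bernstein ideal B(A). -/

import Mathlib

open MvPolynomial

namespace Arrangement

variable {n : ℕ} {ι : Type} [Fintype ι]

/-- The module `D(A)` of logarithmic derivations of the arrangement defined by
the forms `l i`. -/
noncomputable def DA (l : ι → MvPolynomial (Fin n) ℂ) :
    Submodule (MvPolynomial (Fin n) ℂ)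
      (Derivation ℂ (MvPolynomial (Fin n) ℂ) (MvPolynomial (Fin n) ℂ)) where
  carrier := {χ | ∀ i, χ (l i) ∈ Ideal.span {l i}}
  add_mem' := fun hx hy i => by
    simpa using add_mem (hx i) (hy i)
  zero_mem' := fun i => by simp
  smul_mem' := fun r χ hχ i => by
    simpa using Ideal.mul_mem_left _ r (hχ i)

open Classical in
/-- The property characterizing the family of twisted derivatives
`D i = ∂/∂xᵢ + ∑ⱼ sⱼ (∂lⱼ/∂xᵢ)/lⱼ` acting on the localization
`M = ℂ[x,s,1/F]·l^s`. -/
def IsTwisted (l : ι → MvPolynomial (Fin n) ℂ)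
    (D : Fin n → Module.End ℂ
      (Localization.Away (rename Sum.inl (∏ i, l i) : MvPolynomial (Fin n ⊕ ι) ℂ))) : Prop :=
  (∀ (i : Fin n) (r : MvPolynomial (Fin n ⊕ ι) ℂ)
      (m : Localization.Away (rename Sum.inl (∏ i, l i) : MvPolynomial (Fin n ⊕ ι) ℂ)),
      D i (algebraMap _ _ r * m)
        = algebraMap _ _ (pderiv (Sum.inl i) r) * m + algebraMap _ _ r * D i m) ∧
  (∀ i : Fin n,
      algebraMap (MvPolynomial (Fin n ⊕ ι) ℂ) _ (rename Sum.inl (∏ j, l j)) * D i 1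
        = algebraMap _ _ (∑ j, X (Sum.inr j) *
            rename Sum.inl (pderiv i (l j) * ∏ k ∈ Finset.univ.erase j, l k)))

/-- The algebra `W` of operators on `M`, image of the Weyl algebra
`Aₙ(ℂ)[s₁,…,s_p]` acting on `ℂ[x,s,1/F]·l^s`. -/
noncomputable def Wa (l : ι → MvPolynomial (Fin n) ℂ)
    (D : Fin n → Module.End ℂ
      (Localization.Away (rename Sum.inl (∏ i, l i) : MvPolynomial (Fin n ⊕ ι) ℂ))) :
    Subalgebra ℂ (Module.End ℂ
      (Localization.Away (rename Sum.inl (∏ i, l i) : MvPolynomial (Fin n ⊕ ι) ℂ))) :=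
  Algebra.adjoin ℂ
    ((Set.range fun i : Fin n =>
        LinearMap.mulLeft ℂ (algebraMap _ _ (X (Sum.inl i) : MvPolynomial (Fin n ⊕ ι) ℂ))) ∪
     (Set.range fun j : ι =>
        LinearMap.mulLeft ℂ (algebraMap _ _ (X (Sum.inr j) : MvPolynomial (Fin n ⊕ ι) ℂ))) ∪
     Set.range D)

/-- The Bernstein ideal `B(A)`, as the set of polynomials `b(s₁,…,s_p)` such that
`b · l^s = P · l^{s+1}` for some operator `P` in the Weyl algebra. -/
noncomputable def Bideal (l : ι → MvPolynomial (Fin n) ℂ)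
    (D : Fin n → Module.End ℂ
      (Localization.Away (rename Sum.inl (∏ i, l i) : MvPolynomial (Fin n ⊕ ι) ℂ))) :
    Set (MvPolynomial ι ℂ) :=
  {b | ∃ P ∈ Wa l D,
    algebraMap (MvPolynomial (Fin n ⊕ ι) ℂ) _ ((rename Sum.inr b : MvPolynomial (Fin n ⊕ ι) ℂ))
      = P (algebraMap _ _ (rename Sum.inl (∏ i, l i) : MvPolynomial (Fin n ⊕ ι) ℂ))}

/-- The linear functional on `ℂⁿ` associated to a linear form. -/
noncomputable def toLin (f : MvPolynomial (Fin n) ℂ) : (Fin n → ℂ) →ₗ[ℂ] ℂ :=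
  ∑ i, f.coeff (Finsupp.single i 1) • LinearMap.proj i

/-- The hyperplane `ker lᵢ ⊆ ℂⁿ`. -/
noncomputable def hyp (l : ι → MvPolynomial (Fin n) ℂ) (i : ι) : Submodule ℂ (Fin n → ℂ) :=
  LinearMap.ker (toLin (l i))

open Classical in
/-- The intersection lattice `L(A)`: all intersections of nonempty subfamilies. -/
noncomputable def LA (l : ι → MvPolynomial (Fin n) ℂ) : Finset (Submodule ℂ (Fin n → ℂ)) :=
  (Finset.univ.powerset.filter Finset.Nonempty).image fun I : Finset ι => ⨅ i ∈ I, hyp l i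

open Classical in
/-- `J(X) = {i : X ⊆ ker lᵢ}`. -/
noncomputable def JX (l : ι → MvPolynomial (Fin n) ℂ) (Y : Submodule ℂ (Fin n → ℂ)) :
    Finset ι :=
  Finset.univ.filter fun i => Y ≤ hyp l i

/-- `r(X) = n - dim X`, the codimension. -/
noncomputable def rX (Y : Submodule ℂ (Fin n → ℂ)) : ℕ :=
  n - Module.finrank ℂ Y

/-- Irreducibility of the subarrangement with hyperplanes indexed by `J`. -/
def IrredOn (l : ι → MvPolynomial (Fin n) ℂ) (J : Finset ι) : Prop :=
  ¬ ∃ V₁ V₂ : Submodule ℂ (Fin n → ℂ), IsCompl V₁ V₂ ∧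
      (∀ i ∈ J, V₁ ≤ hyp l i ∨ V₂ ≤ hyp l i) ∧
      (∃ i ∈ J, V₁ ≤ hyp l i) ∧ (∃ i ∈ J, V₂ ≤ hyp l i)

open Classical in
/-- `L'(A) = {X ∈ L(A) : A_X irreducible}`. -/
noncomputable def Lprime (l : ι → MvPolynomial (Fin n) ℂ) :
    Finset (Submodule ℂ (Fin n → ℂ)) :=
  (LA l).filter fun Y => IrredOn l (JX l Y)

/-- The polynomial
`b_A = ∏_{X ∈ L'(A)} ∏_{j=0}^{2(card J(X) − r(X))} ((∑_{i ∈ J(X)} sᵢ) + r(X) + j)`. -/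
noncomputable def bGen (l : ι → MvPolynomial (Fin n) ℂ) : MvPolynomial ι ℂ :=
  ∏ Y ∈ Lprime l, ∏ j ∈ Finset.range (2 * ((JX l Y).card - rX (n := n) Y) + 1),
    ((∑ i ∈ JX l Y, X i) + C ((rX (n := n) Y : ℂ) + (j : ℂ)))

end Arrangement

namespace Arrangement

section LinearForms

variable {n : ℕ}

/-- The derivative in the direction `v`. -/
noncomputable def directional (v : Fin n → ℂ) :
    Derivation ℂ (MvPolynomial (Fin n) ℂ) (MvPolynomial (Fin n) ℂ) :=
  ∑ i, v i • pderiv i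

lemma directional_apply (v : Fin n → ℂ) (f : MvPolynomial (Fin n) ℂ) :
    directional v f = ∑ i, v i • pderiv i f := by
  change Derivation.coeFnAddMonoidHom (directional v) f = _
  rw [directional, map_sum, Finset.sum_apply]
  rfl

/-- The linear form, as a polynomial, attached to a linear functional. -/
noncomputable def formPoly : ((Fin n → ℂ) →ₗ[ℂ] ℂ) →ₗ[ℂ] MvPolynomial (Fin n) ℂ :=
  ∑ i, (LinearMap.toSpanSingleton ℂ (MvPolynomial (Fin n) ℂ) (X i)).comp
    (LinearMap.applyₗ (Pi.single i 1))

lemma formPoly_apply (f : (Fin n → ℂ) →ₗ[ℂ] ℂ) :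
    formPoly f = ∑ i, f (Pi.single i 1) • (X i : MvPolynomial (Fin n) ℂ) := by
  simp [formPoly]

lemma aeval_formPoly (f : (Fin n → ℂ) →ₗ[ℂ] ℂ) (q : Fin n → ℂ) :
    aeval q (formPoly f) = f q := by
  conv_rhs => rw [← Finset.univ_sum_single q, map_sum]
  simp only [formPoly_apply, map_sum, map_smul, aeval_X, smul_eq_mul]
  refine Finset.sum_congr rfl fun i _ => ?_
  rw [show (Pi.single i (q i) : Fin n → ℂ) = q i • Pi.single i 1 by
    rw [← Pi.single_smul, smul_eq_mul, mul_one], map_smul, smul_eq_mul, mul_comm]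

lemma pderiv_formPoly (f : (Fin n → ℂ) →ₗ[ℂ] ℂ) (i : Fin n) :
    pderiv i (formPoly f) = C (f (Pi.single i 1)) := by
  simp [formPoly_apply, pderiv_X, Pi.single_apply, smul_eq_C_mul]

lemma directional_formPoly (v : Fin n → ℂ) (f : (Fin n → ℂ) →ₗ[ℂ] ℂ) :
    directional v (formPoly f) = C (f v) := by
  simp only [directional_apply, pderiv_formPoly]
  rw [← aeval_formPoly, formPoly_apply]
  simp [smul_eq_C_mul, mul_comm]

lemma toLin_single (f : MvPolynomial (Fin n) ℂ) (i : Fin n) :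
    toLin f (Pi.single i 1) = f.coeff (Finsupp.single i 1) := by
  simp [toLin, Pi.single_apply]

lemma formPoly_toLin {f : MvPolynomial (Fin n) ℂ} (hf : f.IsHomogeneous 1) :
    formPoly (toLin f) = f := by
  ext m
  simp only [formPoly_apply, toLin_single, coeff_sum, coeff_smul, coeff_X, smul_eq_mul]
  by_cases hm : m.degree = 1
  · obtain ⟨i, rfl⟩ := (Finsupp.sum_eq_one_iff m).1 hm
    rw [Finset.sum_eq_single i] <;>
      simp +contextual [Finsupp.single_left_inj]
  · rw [hf.coeff_eq_zero hm]
    refine Finset.sum_eq_zero fun i _ => ?_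
    rw [if_neg, mul_zero]
    rintro rfl
    simp at hm

lemma toLin_ne_zero {f : MvPolynomial (Fin n) ℂ} (hf : f.IsHomogeneous 1) (h0 : f ≠ 0) :
    toLin f ≠ 0 := fun h => h0 (by rw [← formPoly_toLin hf, h, map_zero])

lemma aeval_eq_toLin {f : MvPolynomial (Fin n) ℂ} (hf : f.IsHomogeneous 1) (q : Fin n → ℂ) :
    aeval q f = toLin f q := by
  conv_lhs => rw [← formPoly_toLin hf]
  exact aeval_formPoly _ _

lemma directional_eq_toLin {f : MvPolynomial (Fin n) ℂ} (hf : f.IsHomogeneous 1)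
    (v : Fin n → ℂ) : directional v f = C (toLin f v) := by
  conv_lhs => rw [← formPoly_toLin hf]
  exact directional_formPoly _ _

lemma pderiv_eq_coeff {f : MvPolynomial (Fin n) ℂ} (hf : f.IsHomogeneous 1)
    (i : Fin n) : pderiv i f = C (f.coeff (Finsupp.single i 1)) := by
  conv_lhs => rw [← formPoly_toLin hf]
  rw [pderiv_formPoly, toLin_single]

/-- Dual bases adapted to a subspace `Y`, with vectors taken in a given supplement of `Y`. -/
lemma exists_dual_coordinates (Y V : Submodule ℂ (Fin n → ℂ)) (hV : V ⊔ Y = ⊤) :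
    ∃ (v : Fin (rX Y) → Fin n → ℂ) (y : Fin (rX Y) → ((Fin n → ℂ) →ₗ[ℂ] ℂ)),
      (∀ a, v a ∈ V) ∧ (∀ a, y a (v a) = 1) ∧ (∀ a, Y ≤ LinearMap.ker (y a)) ∧
      ∀ f : (Fin n → ℂ) →ₗ[ℂ] ℂ, Y ≤ LinearMap.ker f → f = ∑ a, f (v a) • y a := by
  obtain ⟨V', hd, hs⟩ := IsModularLattice.exists_disjoint_and_sup_eq
    (inf_le_right : Y ⊓ V ≤ V)
  have hle : V' ≤ V := hs ▸ le_sup_right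
  have hc : IsCompl V' Y := by
    refine ⟨?_, codisjoint_iff.2 (top_le_iff.1 ?_)⟩
    · rw [disjoint_iff_inf_le] at hd ⊢
      exact fun x hx => hd ⟨⟨hx.2, hle hx.1⟩, hx.1⟩
    · rw [← hV, ← hs]
      exact sup_le (sup_le (inf_le_left.trans le_sup_right) le_sup_left) le_sup_right
  have hr : Module.finrank ℂ V' = rX Y := by
    have := Submodule.finrank_add_eq_of_isCompl hc
    rw [Module.finrank_fin_fun] at this
    unfold rX
    omega
  let b := (Module.finBasisOfFinrankEq ℂ V' hr)
  have hb (a c) : b.coord a (b c) = if c = a then 1 else 0 := by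
    simp [Finsupp.single_apply]
  refine ⟨fun a => b a, fun a => (b.coord a).comp (V'.projectionOnto Y hc),
    fun a => hle (b a).2, fun a => ?_, fun a x hx => ?_, fun f hf => ?_⟩
  · simp
  · simp [Submodule.projectionOnto_apply_eq_zero_iff hc |>.2 hx]
  · refine LinearMap.ext fun x => ?_
    have hx : x ∈ V' ⊔ Y := by rw [hc.sup_eq_top]; trivial
    obtain ⟨z, hz, w, hw, rfl⟩ := Submodule.mem_sup.1 hx
    lift z to V' using hz
    have h1 : f w = 0 := hf hw
    have h2 := congrArg f (congrArg V'.subtype (b.sum_repr z))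
    simp only [map_sum, map_smul, Submodule.subtype_apply] at h2
    simp [h1, Submodule.projectionOnto_apply_eq_zero_iff hc |>.2 hw, ← h2, mul_comm]

end LinearForms

section Operators

variable {n : ℕ} {ι : Type} [Fintype ι]

/-- An abstract model of the module `ℂ[x,s,1/F]·l^s`: a commutative algebra `A` in which the forms
`l i` are invertible, with operators `D i` acting as twisted partial derivatives. -/
structure TwistedAction (l : ι → MvPolynomial (Fin n) ℂ) (A : Type*) [CommRing A]
    [Algebra ℂ A] where
  /-- The structure map on the polynomials in `x`. -/
  xMap : MvPolynomial (Fin n) ℂ →ₐ[ℂ] A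
  /-- The structure map on the polynomials in `s`. -/
  sMap : MvPolynomial ι ℂ →ₐ[ℂ] A
  /-- The inverses of the forms. -/
  inv : ι → A
  /-- The twisted partial derivatives. -/
  D : Fin n → Module.End ℂ A
  xMap_mul_inv : ∀ i, xMap (l i) * inv i = 1
  D_xMap_mul : ∀ i f m, D i (xMap f * m) = xMap (pderiv i f) * m + xMap f * D i m
  D_sMap_mul : ∀ i g m, D i (sMap g * m) = sMap g * D i m
  D_one : ∀ i, D i 1 = ∑ j, toLin (l j) (Pi.single i 1) • (sMap (X j) * inv j)

namespace TwistedAction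

variable {l : ι → MvPolynomial (Fin n) ℂ} {A : Type*} [CommRing A] [Algebra ℂ A]
  (T : TwistedAction l A)

/-- The derivative in the direction `v`, twisted only by the forms with index in `J`. -/
noncomputable def twist (J : Finset ι) (v : Fin n → ℂ) : Module.End ℂ A :=
  ∑ i, v i • T.D i +
    LinearMap.mulLeft ℂ (∑ j ∈ J, toLin (l j) v • (T.sMap (X j) * T.inv j) -
      ∑ j, toLin (l j) v • (T.sMap (X j) * T.inv j))

lemma twist_xMap_mul (J : Finset ι) (v : Fin n → ℂ) (f : MvPolynomial (Fin n) ℂ) (m : A) :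
    T.twist J v (T.xMap f * m) = T.xMap (directional v f) * m + T.xMap f * T.twist J v m := by
  have h : ∑ i, v i • T.D i (T.xMap f * m) =
      T.xMap (directional v f) * m + T.xMap f * ∑ i, v i • T.D i m := by
    simp only [T.D_xMap_mul, directional_apply, map_sum, map_smul, smul_add,
      Finset.sum_add_distrib, Finset.sum_mul, Finset.mul_sum, smul_mul_assoc, mul_smul_comm]
  simp only [twist, LinearMap.add_apply, LinearMap.sum_apply, LinearMap.smul_apply, h,
    LinearMap.mulLeft_apply]
  ring

lemma twist_sMap_mul (J : Finset ι) (v : Fin n → ℂ) (g : MvPolynomial ι ℂ) (m : A) :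
    T.twist J v (T.sMap g * m) = T.sMap g * T.twist J v m := by
  have h : ∑ i, v i • T.D i (T.sMap g * m) = T.sMap g * ∑ i, v i • T.D i m := by
    simp only [T.D_sMap_mul, Finset.mul_sum, mul_smul_comm]
  simp only [twist, LinearMap.add_apply, LinearMap.sum_apply, LinearMap.smul_apply, h,
    LinearMap.mulLeft_apply]
  ring

lemma twist_one (J : Finset ι) (v : Fin n → ℂ) :
    T.twist J v 1 = ∑ j ∈ J, toLin (l j) v • (T.sMap (X j) * T.inv j) := by
  have h : ∑ i, v i • T.D i 1 = ∑ j, toLin (l j) v • (T.sMap (X j) * T.inv j) := by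
    simp only [T.D_one, Finset.smul_sum, smul_smul]
    rw [Finset.sum_comm]
    refine Finset.sum_congr rfl fun j _ => ?_
    rw [← Finset.sum_smul]
    congr 1
    conv_rhs => rw [← aeval_formPoly, formPoly_apply]
    simp [mul_comm]
  simp only [twist, LinearMap.add_apply, LinearMap.sum_apply, LinearMap.smul_apply, h,
    LinearMap.mulLeft_apply]
  ring

lemma twist_eq_sub [DecidableEq ι] {J' J : Finset ι} (h : J' ⊆ J) (v : Fin n → ℂ) :
    T.twist J' v = T.twist J v -
      LinearMap.mulLeft ℂ (∑ j ∈ J \ J', toLin (l j) v • (T.sMap (X j) * T.inv j)) := by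
  refine LinearMap.ext fun m => ?_
  simp only [twist, LinearMap.sub_apply, LinearMap.add_apply, LinearMap.mulLeft_apply,
    ← Finset.sum_sdiff h]
  ring

/-- The operators generated by the polynomials and by the derivatives in the directions of `V`
twisted by the forms with index in `J`. -/
noncomputable def ops (J : Finset ι) (V : Submodule ℂ (Fin n → ℂ)) :
    Subalgebra ℂ (Module.End ℂ A) :=
  Algebra.adjoin ℂ
    ((Set.range fun f => LinearMap.mulLeft ℂ (T.xMap f)) ∪
     (Set.range fun g => LinearMap.mulLeft ℂ (T.sMap g)) ∪
     T.twist J '' V)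

variable {T} {J : Finset ι} {V : Submodule ℂ (Fin n → ℂ)}

lemma mulLeft_xMap_mem (f : MvPolynomial (Fin n) ℂ) :
    LinearMap.mulLeft ℂ (T.xMap f) ∈ T.ops J V :=
  Algebra.subset_adjoin (Or.inl (Or.inl ⟨f, rfl⟩))

lemma mulLeft_sMap_mem (g : MvPolynomial ι ℂ) :
    LinearMap.mulLeft ℂ (T.sMap g) ∈ T.ops J V :=
  Algebra.subset_adjoin (Or.inl (Or.inr ⟨g, rfl⟩))

lemma twist_mem {v : Fin n → ℂ} (hv : v ∈ V) : T.twist J v ∈ T.ops J V :=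
  Algebra.subset_adjoin (Or.inr ⟨v, hv, rfl⟩)

/-- Operators commute with polynomials in `s`. -/
lemma ops_sMap_mul {P : Module.End ℂ A} (hP : P ∈ T.ops J V) (g : MvPolynomial ι ℂ) (m : A) :
    P (T.sMap g * m) = T.sMap g * P m := by
  induction hP using Algebra.adjoin_induction generalizing m with
  | mem P hP =>
    rcases hP with (⟨f, rfl⟩ | ⟨f, rfl⟩) | ⟨v, -, rfl⟩
    · simp only [LinearMap.mulLeft_apply]; ring
    · simp only [LinearMap.mulLeft_apply]; ring
    · exact T.twist_sMap_mul J v g m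
  | algebraMap r => simp [Module.algebraMap_end_apply]
  | add P Q _ _ hP hQ => simp only [LinearMap.add_apply, hP, hQ, mul_add]
  | mul P Q _ _ hP hQ => simp only [Module.End.mul_apply, hP, hQ]

/-- Operators commute with polynomials in `x` that are constant in the allowed directions. -/
lemma ops_xMap_mul {P : Module.End ℂ A} (hP : P ∈ T.ops J V) {f : MvPolynomial (Fin n) ℂ}
    (hf : ∀ v ∈ V, directional v f = 0) (m : A) :
    P (T.xMap f * m) = T.xMap f * P m := by
  induction hP using Algebra.adjoin_induction generalizing m with
  | mem P hP =>
    rcases hP with (⟨f, rfl⟩ | ⟨f, rfl⟩) | ⟨v, hv, rfl⟩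
    · simp only [LinearMap.mulLeft_apply]; ring
    · simp only [LinearMap.mulLeft_apply]; ring
    · rw [T.twist_xMap_mul J v f m, hf v hv, map_zero, zero_mul, zero_add]
  | algebraMap r => simp [Module.algebraMap_end_apply]
  | add P Q _ _ hP hQ => simp only [LinearMap.add_apply, hP, hQ, mul_add]
  | mul P Q _ _ hP hQ => simp only [Module.End.mul_apply, hP, hQ]

/-- Enlarging the twist by forms that are constant in the allowed directions. -/
lemma ops_le_ops {J' : Finset ι} {V' : Submodule ℂ (Fin n → ℂ)} (hJ : J' ⊆ J) (hV : V' ≤ V)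
    (h : ∀ j ∈ J, j ∉ J' → ∀ v ∈ V', toLin (l j) v = 0) : T.ops J' V' ≤ T.ops J V := by
  classical
  refine Algebra.adjoin_le ?_
  rintro P ((⟨f, rfl⟩ | ⟨f, rfl⟩) | ⟨v, hv, rfl⟩)
  · exact mulLeft_xMap_mem f
  · exact mulLeft_sMap_mem f
  · rw [T.twist_eq_sub hJ, Finset.sum_eq_zero, LinearMap.mulLeft_zero_eq_zero, sub_zero]
    · exact twist_mem (hV hv)
    · intro j hj
      rw [Finset.mem_sdiff] at hj
      rw [h j hj.1 hj.2 v hv, zero_smul]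

/-- Denominators created by enlarging the twist can be cleared. -/
lemma exists_clear_denominators [DecidableEq ι] {J' : Finset ι} (hJ : J' ⊆ J)
    {P : Module.End ℂ A} (hP : P ∈ T.ops J' V) (k : ℕ) :
    ∃ N : ℕ, ∃ Q ∈ T.ops J V, ∀ m, T.xMap (∏ j ∈ J \ J', l j) ^ N * P m =
      Q (T.xMap (∏ j ∈ J \ J', l j) ^ k * m) := by
  set G := ∏ j ∈ J \ J', l j with hG
  induction hP using Algebra.adjoin_induction generalizing k with
  | mem P hP =>
    rcases hP with (⟨f, rfl⟩ | ⟨f, rfl⟩) | ⟨v, hv, rfl⟩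
    · exact ⟨k, _, mulLeft_xMap_mem f, fun m => by simp only [LinearMap.mulLeft_apply]; ring⟩
    · exact ⟨k, _, mulLeft_sMap_mem f, fun m => by simp only [LinearMap.mulLeft_apply]; ring⟩
    · refine ⟨k + 1, LinearMap.mulLeft ℂ (T.xMap G) * T.twist J v -
        ∑ j ∈ J \ J', toLin (l j) v • (LinearMap.mulLeft ℂ (T.sMap (X j)) *
          LinearMap.mulLeft ℂ (T.xMap (∏ i ∈ (J \ J').erase j, l i))) -
        LinearMap.mulLeft ℂ (T.xMap ((k : MvPolynomial (Fin n) ℂ) * directional v G)), ?_, ?_⟩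
      · refine sub_mem (sub_mem (mul_mem (mulLeft_xMap_mem _) (twist_mem hv))
          (sum_mem fun j _ => Subalgebra.smul_mem _ (mul_mem (mulLeft_sMap_mem _)
            (mulLeft_xMap_mem _)) _)) (mulLeft_xMap_mem _)
      · intro m
        have e : ∀ j ∈ J \ J', T.xMap G * T.inv j = T.xMap (∏ i ∈ (J \ J').erase j, l i) := by
          intro j hj
          rw [hG, ← Finset.mul_prod_erase _ _ hj, map_mul, mul_right_comm, T.xMap_mul_inv, one_mul]
        have e2 : T.xMap G * ∑ j ∈ J \ J', toLin (l j) v • (T.sMap (X j) * T.inv j) =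
            ∑ j ∈ J \ J', toLin (l j) v •
              (T.sMap (X j) * T.xMap (∏ i ∈ (J \ J').erase j, l i)) := by
          rw [Finset.mul_sum]
          refine Finset.sum_congr rfl fun j hj => ?_
          rw [← e j hj, mul_smul_comm]
          congr 1
          ring
        have e3 : T.xMap G * T.xMap (directional v (G ^ k)) =
            T.xMap ((k : MvPolynomial (Fin n) ℂ) * directional v G) * T.xMap G ^ k := by
          rw [← map_mul, ← map_pow, ← map_mul, Derivation.leibniz_pow]
          congr 1
          rcases k with _ | k
          · simp
          · simp only [smul_eq_mul, nsmul_eq_mul, Nat.add_sub_cancel]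
            ring
        rw [T.twist_eq_sub hJ]
        simp only [LinearMap.sub_apply, Module.End.mul_apply, LinearMap.mulLeft_apply,
          LinearMap.sum_apply, LinearMap.smul_apply]
        rw [← map_pow, ← map_pow, T.twist_xMap_mul, mul_add, ← mul_assoc (T.xMap G), e3]
        have e4 : ∑ j ∈ J \ J', toLin (l j) v • (T.sMap (X j) *
            (T.xMap (∏ i ∈ (J \ J').erase j, l i) * (T.xMap (G ^ k) * m))) =
            (∑ j ∈ J \ J', toLin (l j) v •
              (T.sMap (X j) * T.xMap (∏ i ∈ (J \ J').erase j, l i))) * (T.xMap (G ^ k) * m) := by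
          rw [Finset.sum_mul]
          refine Finset.sum_congr rfl fun j _ => ?_
          rw [smul_mul_assoc]
          congr 1
          ring
        rw [e4, ← e2]
        simp only [map_pow]
        ring
  | algebraMap r =>
    exact ⟨k, _, Subalgebra.algebraMap_mem _ r, fun m => by simp [Module.algebraMap_end_apply]⟩
  | add P₁ P₂ _ _ h₁ h₂ =>
    obtain ⟨N₁, Q₁, hQ₁, e₁⟩ := h₁ k
    obtain ⟨N₂, Q₂, hQ₂, e₂⟩ := h₂ k
    refine ⟨N₁ + N₂, LinearMap.mulLeft ℂ (T.xMap (G ^ N₂)) * Q₁ +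
      LinearMap.mulLeft ℂ (T.xMap (G ^ N₁)) * Q₂, add_mem (mul_mem (mulLeft_xMap_mem _) hQ₁)
      (mul_mem (mulLeft_xMap_mem _) hQ₂), fun m => ?_⟩
    simp only [LinearMap.add_apply, Module.End.mul_apply, LinearMap.mulLeft_apply, ← e₁, ← e₂,
      map_pow]
    ring
  | mul P₁ P₂ _ _ h₁ h₂ =>
    obtain ⟨N₂, Q₂, hQ₂, e₂⟩ := h₂ k
    obtain ⟨N₁, Q₁, hQ₁, e₁⟩ := h₁ N₂
    exact ⟨N₁, Q₁ * Q₂, mul_mem hQ₁ hQ₂, fun m => by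
      simp only [Module.End.mul_apply, e₁, e₂]⟩

end TwistedAction

end Operators

section Flats

variable {n : ℕ} {ι : Type} [Fintype ι] {l : ι → MvPolynomial (Fin n) ℂ}

lemma mem_hyp {i : ι} {q : Fin n → ℂ} : q ∈ hyp l i ↔ toLin (l i) q = 0 := LinearMap.mem_ker

lemma mem_JX {Y : Submodule ℂ (Fin n → ℂ)} {i : ι} : i ∈ JX l Y ↔ Y ≤ hyp l i := by
  simp [JX]

lemma JX_anti {Y Z : Submodule ℂ (Fin n → ℂ)} (h : Y ≤ Z) : JX l Z ⊆ JX l Y := fun _ hi =>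
  mem_JX.2 (h.trans (mem_JX.1 hi))

lemma subset_JX_iInf (S : Finset ι) : S ⊆ JX l (⨅ i ∈ S, hyp l i) := fun i hi =>
  mem_JX.2 (iInf₂_le i hi)

lemma iInf_JX_le_iInf (S : Finset ι) :
    ⨅ i ∈ JX l (⨅ i ∈ S, hyp l i), hyp l i ≤ ⨅ i ∈ S, hyp l i :=
  biInf_mono (subset_JX_iInf S)

lemma le_iInf_JX (Y : Submodule ℂ (Fin n → ℂ)) : Y ≤ ⨅ i ∈ JX l Y, hyp l i :=
  le_iInf₂ fun _ hi => mem_JX.1 hi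

open Classical in
/-- The product of the factors attached to the dense flats that contain `Y`. -/
noncomputable def denseFactor (l : ι → MvPolynomial (Fin n) ℂ) (N : ℕ)
    (Y : Submodule ℂ (Fin n → ℂ)) : MvPolynomial ι ℂ :=
  ∏ Z ∈ (Lprime l).filter (Y ≤ ·), ∏ j ∈ Finset.range (N + 1),
    ((∑ i ∈ JX l Z, X i) + C ((rX (n := n) Z : ℂ) + (j : ℂ)))

open Classical in
lemma prod_range_dvd_of_subset {s t : Finset (Submodule ℂ (Fin n → ℂ))} (hst : s ⊆ t)
    {N N' : ℕ} (hN : N ≤ N') :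
    (∏ Z ∈ s, ∏ j ∈ Finset.range (N + 1),
      ((∑ i ∈ JX l Z, X i) + C ((rX (n := n) Z : ℂ) + (j : ℂ))) : MvPolynomial ι ℂ) ∣
    ∏ Z ∈ t, ∏ j ∈ Finset.range (N' + 1),
      ((∑ i ∈ JX l Z, X i) + C ((rX (n := n) Z : ℂ) + (j : ℂ))) :=
  (Finset.prod_dvd_prod_of_dvd _ _ fun _ _ => Finset.prod_dvd_prod_of_subset _ _ _
    (Finset.range_mono (by omega))).trans (Finset.prod_dvd_prod_of_subset _ _ _ hst)

open Classical in
lemma denseFactor_dvd {N N' : ℕ} (hN : N ≤ N') {Y Z : Submodule ℂ (Fin n → ℂ)} (h : Z ≤ Y) :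
    denseFactor l N Y ∣ denseFactor l N' Z :=
  prod_range_dvd_of_subset
    (fun _ hW => Finset.mem_filter.2 ⟨(Finset.mem_filter.1 hW).1,
      h.trans (Finset.mem_filter.1 hW).2⟩) hN

lemma directional_prod_eq_zero (hlh : ∀ i, (l i).IsHomogeneous 1) {J : Finset ι}
    {v : Fin n → ℂ} (h : ∀ j ∈ J, toLin (l j) v = 0) : directional v (∏ j ∈ J, l j) = 0 := by
  classical
  induction J using Finset.induction_on with
  | empty => simp
  | insert a s ha ih =>
    rw [Finset.prod_insert ha, Derivation.leibniz, ih fun j hj => h j (Finset.mem_insert_of_mem hj),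
      directional_eq_toLin (hlh a), h a (Finset.mem_insert_self _ _)]
    simp

end Flats

namespace TwistedAction

variable {n : ℕ} {ι : Type} [Fintype ι] {l : ι → MvPolynomial (Fin n) ℂ}
  {A : Type*} [CommRing A] [Algebra ℂ A] {T : TwistedAction l A} {J : Finset ι}
  {V : Submodule ℂ (Fin n → ℂ)}

variable (T) in
/-- The module generated by the product of the forms with index in `J`. -/
noncomputable def orbit (J : Finset ι) (V : Submodule ℂ (Fin n → ℂ)) : Submodule ℂ A :=
  (Subalgebra.toSubmodule (T.ops J V)).map (LinearMap.applyₗ (T.xMap (∏ j ∈ J, l j)))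

lemma mem_orbit {a : A} : a ∈ T.orbit J V ↔ ∃ P ∈ T.ops J V, P (T.xMap (∏ j ∈ J, l j)) = a :=
  Iff.rfl

lemma ops_apply_mem_orbit {P : Module.End ℂ A} (hP : P ∈ T.ops J V) {a : A}
    (ha : a ∈ T.orbit J V) : P a ∈ T.orbit J V := by
  obtain ⟨Q, hQ, rfl⟩ := mem_orbit.1 ha
  exact mem_orbit.2 ⟨P * Q, mul_mem hP hQ, rfl⟩

lemma sMap_mul_mem_orbit (g : MvPolynomial ι ℂ) {a : A} (ha : a ∈ T.orbit J V) :
    T.sMap g * a ∈ T.orbit J V :=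
  ops_apply_mem_orbit (mulLeft_sMap_mem g) ha

lemma xMap_mul_mem_orbit (f : MvPolynomial (Fin n) ℂ) {a : A} (ha : a ∈ T.orbit J V) :
    T.xMap f * a ∈ T.orbit J V :=
  ops_apply_mem_orbit (mulLeft_xMap_mem f) ha

lemma sMap_mul_mem_orbit_of_dvd {b c : MvPolynomial ι ℂ} (h : b ∣ c) {a : A}
    (ha : T.sMap b * a ∈ T.orbit J V) : T.sMap c * a ∈ T.orbit J V := by
  obtain ⟨d, rfl⟩ := h
  rw [mul_comm b, map_mul, mul_assoc]
  exact sMap_mul_mem_orbit d ha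

lemma sMap_mem_orbit_of_dvd {b c : MvPolynomial ι ℂ} (h : b ∣ c)
    (hb : T.sMap b ∈ T.orbit J V) : T.sMap c ∈ T.orbit J V := by
  rw [← mul_one (T.sMap _)] at hb ⊢
  exact sMap_mul_mem_orbit_of_dvd h hb

/-- The coefficient ideal in `ℂ[x]` of the multiples of `b` that lie in the orbit. -/
def coeffIdeal (T : TwistedAction l A) (J : Finset ι) (V : Submodule ℂ (Fin n → ℂ))
    (b : MvPolynomial ι ℂ) : Ideal (MvPolynomial (Fin n) ℂ) where
  carrier := {f | T.sMap b * T.xMap f ∈ T.orbit J V}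
  add_mem' hf hg := by
    simp only [Set.mem_ofPred_eq, map_add, mul_add]
    exact add_mem hf hg
  zero_mem' := by simp
  smul_mem' c f hf := by
    simp only [Set.mem_ofPred_eq, smul_eq_mul, map_mul]
    rw [mul_left_comm]
    exact xMap_mul_mem_orbit c hf

lemma mem_coeffIdeal {b : MvPolynomial ι ℂ} {f : MvPolynomial (Fin n) ℂ} :
    f ∈ T.coeffIdeal J V b ↔ T.sMap b * T.xMap f ∈ T.orbit J V := Iff.rfl

/-- The operator `∑ ∂ₐ yₐ` acts on a homogeneous multiple of `l^s` by a scalar. -/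
lemma sum_twist_mul (hlh : ∀ i, (l i).IsHomogeneous 1) {r : ℕ} (v : Fin r → Fin n → ℂ)
    (y : Fin r → ((Fin n → ℂ) →ₗ[ℂ] ℂ)) (hy : ∀ a, y a (v a) = 1)
    (hJ : ∀ j ∈ J, toLin (l j) = ∑ a, toLin (l j) (v a) • y a) (d : ℕ)
    (m : MvPolynomial (Fin n) ℂ)
    (hm : ∑ a, formPoly (y a) * directional (v a) m = d * m) (b : MvPolynomial ι ℂ) :
    ∑ a, T.twist J (v a) (T.sMap b * T.xMap (formPoly (y a) * m)) =
      T.sMap (b * ((∑ i ∈ J, X i) + C ((r : ℂ) + (d : ℂ)))) * T.xMap m := by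
  have h1 : ∀ a, T.twist J (v a) (T.sMap b * T.xMap (formPoly (y a) * m)) =
      T.sMap b * (T.xMap m + T.xMap (formPoly (y a) * directional (v a) m) +
        T.xMap m * ∑ j ∈ J, T.xMap (toLin (l j) (v a) • formPoly (y a)) *
          (T.sMap (X j) * T.inv j)) := by
    intro a
    rw [T.twist_sMap_mul, ← mul_one (T.xMap (formPoly (y a) * m)), T.twist_xMap_mul, T.twist_one,
      Derivation.leibniz, directional_formPoly, hy]
    congr 1
    simp only [map_one, smul_eq_mul, mul_one, map_add, map_mul, map_smul, Finset.mul_sum]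
    rw [add_comm (T.xMap (formPoly (y a)) * _)]
    congr 1
    refine Finset.sum_congr rfl fun j _ => ?_
    rw [mul_smul_comm, smul_mul_assoc, mul_smul_comm]
    congr 1
    ring
  have h2 : ∑ a, ∑ j ∈ J, T.xMap (toLin (l j) (v a) • formPoly (y a)) *
      (T.sMap (X j) * T.inv j) = T.sMap (∑ j ∈ J, X j) := by
    rw [Finset.sum_comm, map_sum]
    refine Finset.sum_congr rfl fun j hj => ?_
    rw [← Finset.sum_mul, ← map_sum]
    have : ∑ a, toLin (l j) (v a) • formPoly (y a) = l j := by
      conv_rhs => rw [← formPoly_toLin (hlh j), hJ j hj]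
      simp only [map_sum, map_smul]
    rw [this, mul_left_comm, T.xMap_mul_inv, mul_one]
  simp only [h1]
  rw [← Finset.mul_sum, Finset.sum_add_distrib, Finset.sum_add_distrib, ← Finset.mul_sum, h2,
    ← map_sum _ fun a => formPoly (y a) * directional (v a) m, hm]
  simp only [Finset.sum_const, Finset.card_univ, Fintype.card_fin, nsmul_eq_mul, map_mul, map_add,
    map_natCast]
  ring

/-- Descent along powers of the ideal of a flat. -/
lemma sMap_mul_prod_mem_orbit (hlh : ∀ i, (l i).IsHomogeneous 1) {r : ℕ}
    (v : Fin r → Fin n → ℂ) (y : Fin r → ((Fin n → ℂ) →ₗ[ℂ] ℂ)) (hv : ∀ a, v a ∈ V)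
    (hy : ∀ a, y a (v a) = 1) (hyy : ∀ c, y c = ∑ a, y c (v a) • y a)
    (hJ : ∀ j ∈ J, toLin (l j) = ∑ a, toLin (l j) (v a) • y a) (b : MvPolynomial ι ℂ) (k : ℕ) :
    ∀ d : ℕ, (∀ L : List (Fin r), L.length = d + k →
        T.sMap b * T.xMap (L.map fun a => formPoly (y a)).prod ∈ T.orbit J V) →
      ∀ L : List (Fin r), L.length = d →
        T.sMap (b * ∏ i ∈ Finset.range k, ((∑ j ∈ J, X j) + C ((r : ℂ) + ((d + i : ℕ) : ℂ)))) *
          T.xMap (L.map fun a => formPoly (y a)).prod ∈ T.orbit J V := by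
  have hE : ∀ L : List (Fin r),
      ∑ a, formPoly (y a) * directional (v a) (L.map fun a => formPoly (y a)).prod =
        (L.length : MvPolynomial (Fin n) ℂ) * (L.map fun a => formPoly (y a)).prod := by
    intro L
    induction L with
    | nil => simp
    | cons c L ih =>
      have hc : ∑ a, formPoly (y a) * C (y c (v a)) = formPoly (y c) := by
        conv_rhs => rw [hyy c]
        simp only [map_sum, map_smul, smul_eq_C_mul, mul_comm]
      simp only [List.map_cons, List.prod_cons, Derivation.leibniz, smul_eq_mul,
        directional_formPoly, mul_add, Finset.sum_add_distrib, List.length_cons, Nat.cast_add,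
        Nat.cast_one, add_mul, one_mul]
      congr 1
      · rw [mul_left_comm, ← ih, Finset.mul_sum]
        exact Finset.sum_congr rfl fun _ _ => by ring
      · conv_rhs => rw [← hc]
        rw [Finset.sum_mul]
        exact Finset.sum_congr rfl fun _ _ => by ring
  induction k with
  | zero =>
    intro d h L hL
    simpa using h L hL
  | succ k ih =>
    intro d h L hL
    have h' := ih (d + 1) fun L hL => h L (by omega)
    have := sum_twist_mul (T := T) hlh v y hy hJ d _ (by rw [hE L, hL])
      (b * ∏ i ∈ Finset.range k, ((∑ j ∈ J, X j) + C ((r : ℂ) + ((d + 1 + i : ℕ) : ℂ))))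
    rw [mul_assoc] at this
    rw [Finset.prod_range_succ', add_zero]
    simp only [add_assoc, add_comm (1 : ℕ)] at this ⊢
    rw [← this]
    refine sum_mem fun a _ => ops_apply_mem_orbit (twist_mem (hv a)) ?_
    have := h' (a :: L) (by simp [hL])
    simpa only [List.map_cons, List.prod_cons, add_assoc, add_comm (1 : ℕ)] using this

/-- The forms vanishing on a flat have a power in an ideal that contains powers of the products of
the forms outside of each larger flat. -/
lemma exists_list_prod_mem [DecidableEq ι] (hlh : ∀ i, (l i).IsHomogeneous 1)
    {Y : Submodule ℂ (Fin n → ℂ)} (I : Ideal (MvPolynomial (Fin n) ℂ))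
    (hI : ∀ S : Finset ι, Y < ⨅ i ∈ S, hyp l i → ∃ k : ℕ,
      (∏ j ∈ JX l Y \ JX l (⨅ i ∈ S, hyp l i), l j) ^ k ∈ I) {r : ℕ}
    (y : Fin r → ((Fin n → ℂ) →ₗ[ℂ] ℂ)) (hy : ∀ a, Y ≤ LinearMap.ker (y a)) :
    ∃ K : ℕ, ∀ L : List (Fin r), L.length = K → (L.map fun a => formPoly (y a)).prod ∈ I := by
  have hrad : Ideal.span (Set.range fun a => formPoly (y a)) ≤ I.radical := by
    rw [Ideal.span_le]
    rintro _ ⟨a, rfl⟩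
    rw [SetLike.mem_coe, ← vanishingIdeal_zeroLocus_eq_radical (K := ℂ)]
    intro q hq
    rw [aeval_formPoly]
    refine hy a (by_contra fun hqY => ?_)
    let S : Finset ι := (JX l Y).filter fun i => toLin (l i) q = 0
    have hqS : q ∈ ⨅ i ∈ S, hyp l i := by
      simp only [Submodule.mem_iInf]
      exact fun i hi => mem_hyp.2 (Finset.mem_filter.1 hi).2
    have hYS : Y ≤ ⨅ i ∈ S, hyp l i :=
      le_iInf₂ fun i hi => mem_JX.1 (Finset.mem_filter.1 hi).1
    obtain ⟨k, hk⟩ := hI S (lt_of_le_of_ne hYS fun h => hqY (h ▸ hqS))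
    have h0 := hq _ hk
    rw [map_pow, map_prod] at h0
    obtain ⟨j, hj, hj0⟩ := Finset.prod_eq_zero_iff.1 (eq_zero_of_pow_eq_zero h0)
    rw [Finset.mem_sdiff] at hj
    rw [aeval_eq_toLin (hlh j)] at hj0
    exact hj.2 (subset_JX_iInf S (Finset.mem_filter.2 ⟨hj.1, hj0⟩))
  obtain ⟨K, hK⟩ := Ideal.exists_pow_le_of_le_radical_of_fg hrad
    (Submodule.fg_span (Set.finite_range _))
  refine ⟨K, fun L hL => hK ?_⟩
  subst hL
  clear hK
  induction L with
  | nil => simp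
  | cons a L ih =>
    rw [List.map_cons, List.prod_cons, List.length_cons, pow_succ']
    exact Ideal.mul_mem_mul (Ideal.subset_span ⟨a, rfl⟩) ih

/-- Passing from a larger flat to a smaller one, at the cost of denominators. -/
lemma exists_pow_mem_coeffIdeal [DecidableEq ι] {J' : Finset ι} (hJ : J' ⊆ J)
    {b : MvPolynomial ι ℂ} (hb : T.sMap b ∈ T.orbit J' V) :
    ∃ k : ℕ, (∏ j ∈ J \ J', l j) ^ k ∈ T.coeffIdeal J V b := by
  obtain ⟨P, hP, e⟩ := mem_orbit.1 hb
  obtain ⟨N, Q, hQ, h⟩ := exists_clear_denominators hJ hP 1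
  refine ⟨N, mem_orbit.2 ⟨Q, hQ, ?_⟩⟩
  rw [← Finset.prod_sdiff hJ, map_mul, ← pow_one (T.xMap (∏ j ∈ J \ J', l j)), ← h, e, map_pow,
    mul_comm]

/-- The inductive step at an irreducible flat. -/
lemma exists_mem_orbit_of_irreducible (hlh : ∀ i, (l i).IsHomogeneous 1)
    {Y : Submodule ℂ (Fin n → ℂ)} (hYL : Y ∈ Lprime l)
    (hV : V ⊔ Y = ⊤)
    (ih : ∀ S : Finset ι, Y < ⨅ i ∈ S, hyp l i → ∃ N,
      T.sMap (denseFactor l N (⨅ i ∈ S, hyp l i)) ∈ T.orbit (JX l (⨅ i ∈ S, hyp l i)) V) :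
    ∃ N, T.sMap (denseFactor l N Y) ∈ T.orbit (JX l Y) V := by
  classical
  have ih' : ∀ S : Finset ι, ∃ N, Y < ⨅ i ∈ S, hyp l i →
      T.sMap (denseFactor l N (⨅ i ∈ S, hyp l i)) ∈ T.orbit (JX l (⨅ i ∈ S, hyp l i)) V :=
    fun S => by
      by_cases h : Y < ⨅ i ∈ S, hyp l i
      · exact (ih S h).imp fun _ h _ => h
      · exact ⟨0, fun h' => absurd h' h⟩
  choose N hN using ih'
  set M := Finset.univ.sup N
  set b : MvPolynomial ι ℂ := ∏ Z ∈ (Lprime l).filter (Y < ·), ∏ j ∈ Finset.range (M + 1),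
    ((∑ i ∈ JX l Z, X i) + C ((rX (n := n) Z : ℂ) + (j : ℂ))) with hb
  obtain ⟨v, y, hv, hy, hyY, hspan⟩ := exists_dual_coordinates Y V hV
  obtain ⟨K, hK⟩ := exists_list_prod_mem hlh (T.coeffIdeal (JX l Y) V b) (fun S hS =>
    exists_pow_mem_coeffIdeal (JX_anti hS.le) (sMap_mem_orbit_of_dvd
      (prod_range_dvd_of_subset (fun Z hZ => by
        rw [Finset.mem_filter] at hZ ⊢
        exact ⟨hZ.1, hS.trans_le hZ.2⟩) (Finset.le_sup (Finset.mem_univ S))) (hN S hS))) y hyY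
  have h := sMap_mul_prod_mem_orbit (T := T) hlh v y hv hy (fun c => hspan _ (hyY c))
    (fun j hj => hspan _ (mem_JX.1 hj)) b K 0 (fun L hL => hK L (by simpa using hL)) [] rfl
  rw [List.map_nil, List.prod_nil, map_one, mul_one] at h
  refine ⟨M + K, sMap_mem_orbit_of_dvd ?_ h⟩
  have hf : (Lprime l).filter (Y ≤ ·) = insert Y ((Lprime l).filter (Y < ·)) := by
    ext Z
    simp only [Finset.mem_filter, Finset.mem_insert, le_iff_eq_or_lt]
    constructor
    · rintro ⟨h, rfl | h'⟩
      · exact Or.inl rfl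
      · exact Or.inr ⟨h, h'⟩
    · rintro (rfl | h)
      · exact ⟨hYL, Or.inl rfl⟩
      · exact ⟨h.1, Or.inr h.2⟩
  rw [denseFactor, hf, Finset.prod_insert (by simp), mul_comm]
  refine mul_dvd_mul ?_ (prod_range_dvd_of_subset subset_rfl (by omega))
  simp only [zero_add]
  exact Finset.prod_dvd_prod_of_subset _ _ _ (Finset.range_mono (by omega))

/-- The properties of a factor of a reducible flat. -/
lemma factor_properties (hlh : ∀ i, (l i).IsHomogeneous 1) (hl0 : ∀ i, l i ≠ 0)
    {Y V₁ V₂ : Submodule ℂ (Fin n → ℂ)} (hc : V₁ ⊔ V₂ = ⊤) {J₁ : Finset ι}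
    (hJ₁ : ∀ i, i ∈ J₁ ↔ i ∈ JX l Y ∧ V₁ ≤ hyp l i) (h₂ : ∃ i ∈ JX l Y, V₂ ≤ hyp l i) :
    V₁ ≤ ⨅ i ∈ J₁, hyp l i ∧ Y < ⨅ i ∈ J₁, hyp l i ∧ JX l (⨅ i ∈ J₁, hyp l i) = J₁ := by
  have hV₁ : V₁ ≤ ⨅ i ∈ J₁, hyp l i := le_iInf₂ fun i hi => ((hJ₁ i).1 hi).2
  have hY : Y ≤ ⨅ i ∈ J₁, hyp l i := le_iInf₂ fun i hi => mem_JX.1 ((hJ₁ i).1 hi).1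
  refine ⟨hV₁, lt_of_le_not_ge hY fun h => ?_, subset_antisymm (fun i hi => ?_)
    (subset_JX_iInf J₁)⟩
  · obtain ⟨i, hi, hi₂⟩ := h₂
    have : (⊤ : Submodule ℂ (Fin n → ℂ)) ≤ hyp l i :=
      hc ▸ sup_le ((hV₁.trans h).trans (mem_JX.1 hi)) hi₂
    exact toLin_ne_zero (hlh i) (hl0 i) (LinearMap.ext fun q => this (Submodule.mem_top (x := q)))
  · rw [mem_JX] at hi
    exact (hJ₁ i).2 ⟨mem_JX.2 (hY.trans hi), hV₁.trans hi⟩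

lemma inf_sup_eq_top {Y Y₁ Y₂ : Submodule ℂ (Fin n → ℂ)} (hV : V ⊔ Y = ⊤) (h₁ : Y ≤ Y₁)
    (h₂ : Y ≤ Y₂) (h : Y₁ ⊔ Y₂ = ⊤) : V ⊓ Y₂ ⊔ Y₁ = ⊤ := by
  have : V ⊓ Y₂ ⊔ Y = Y₂ := by
    rw [sup_comm, inf_comm, inf_comm Y₂, ← sup_inf_assoc_of_le V h₂, sup_comm, hV, top_inf_eq]
  rw [← sup_eq_right.2 h₁, ← sup_assoc, this, sup_comm, h]

/-- The inductive step at a reducible flat. -/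
lemma exists_mem_orbit_of_reducible (hlh : ∀ i, (l i).IsHomogeneous 1) (hl0 : ∀ i, l i ≠ 0)
    {Y : Submodule ℂ (Fin n → ℂ)} (hred : ¬ IrredOn l (JX l Y)) (hV : V ⊔ Y = ⊤)
    (ih : ∀ S : Finset ι, Y < ⨅ i ∈ S, hyp l i → ∀ V' : Submodule ℂ (Fin n → ℂ),
      V' ⊔ ⨅ i ∈ S, hyp l i = ⊤ → ∃ N,
      T.sMap (denseFactor l N (⨅ i ∈ S, hyp l i)) ∈ T.orbit (JX l (⨅ i ∈ S, hyp l i)) V') :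
    ∃ N, T.sMap (denseFactor l N Y) ∈ T.orbit (JX l Y) V := by
  classical
  obtain ⟨V₁, V₂, hc, hcov, h₁, h₂⟩ := not_not.1 hred
  let J₁ : Finset ι := (JX l Y).filter fun i => V₁ ≤ hyp l i
  let J₂ : Finset ι := (JX l Y).filter fun i => V₂ ≤ hyp l i
  set Y₁ := ⨅ i ∈ J₁, hyp l i with hY₁
  set Y₂ := ⨅ i ∈ J₂, hyp l i with hY₂
  obtain ⟨hV₁, hlt₁, hJ₁⟩ : V₁ ≤ Y₁ ∧ Y < Y₁ ∧ JX l Y₁ = J₁ :=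
    factor_properties hlh hl0 hc.sup_eq_top (fun i => Finset.mem_filter) h₂
  obtain ⟨hV₂, hlt₂, hJ₂⟩ : V₂ ≤ Y₂ ∧ Y < Y₂ ∧ JX l Y₂ = J₂ :=
    factor_properties hlh hl0 hc.symm.sup_eq_top (fun i => Finset.mem_filter) h₁
  have htop : Y₁ ⊔ Y₂ = ⊤ := top_le_iff.1 (hc.sup_eq_top ▸ sup_le_sup hV₁ hV₂)
  have hnot : ∀ i, Y₁ ≤ hyp l i → Y₂ ≤ hyp l i → False := fun i hi₁ hi₂ =>
    toLin_ne_zero (hlh i) (hl0 i) (LinearMap.ext fun q =>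
      (htop ▸ sup_le hi₁ hi₂ : (⊤ : Submodule ℂ (Fin n → ℂ)) ≤ hyp l i) (Submodule.mem_top (x := q)))
  have hdisj : Disjoint J₁ J₂ := Finset.disjoint_left.2 fun i hi₁ hi₂ =>
    hnot i (mem_JX.1 (hJ₁ ▸ hi₁)) (mem_JX.1 (hJ₂ ▸ hi₂))
  have hunion : JX l Y = J₁ ∪ J₂ := by
    rw [← Finset.filter_or]
    exact (Finset.filter_true_of_mem hcov).symm
  have hv₁ : ∀ j ∈ J₁, ∀ v ∈ V ⊓ Y₁, toLin (l j) v = 0 := fun j hj v hv =>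
    mem_hyp.1 (mem_JX.1 (hJ₁ ▸ hj : j ∈ JX l Y₁) hv.2)
  have hv₂ : ∀ j ∈ J₂, ∀ v ∈ V ⊓ Y₂, toLin (l j) v = 0 := fun j hj v hv =>
    mem_hyp.1 (mem_JX.1 (hJ₂ ▸ hj : j ∈ JX l Y₂) hv.2)
  obtain ⟨N₁, hN₁⟩ := ih J₁ hlt₁ (V ⊓ Y₂) (inf_sup_eq_top hV hlt₁.le hlt₂.le htop)
  obtain ⟨N₂, hN₂⟩ := ih J₂ hlt₂ (V ⊓ Y₁)
    (inf_sup_eq_top hV hlt₂.le hlt₁.le ((sup_comm _ _).trans htop))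
  rw [← hY₁, hJ₁] at hN₁
  rw [← hY₂, hJ₂] at hN₂
  obtain ⟨P₁, hP₁, e₁⟩ := mem_orbit.1 hN₁
  obtain ⟨P₂, hP₂, e₂⟩ := mem_orbit.1 hN₂
  have hP₁' : P₁ ∈ T.ops (JX l Y) V := by
    refine ops_le_ops (hunion ▸ Finset.subset_union_left) inf_le_left (fun j hj hj' => ?_) hP₁
    exact hv₂ j ((Finset.mem_union.1 (hunion ▸ hj)).resolve_left hj')
  have hP₂' : P₂ ∈ T.ops (JX l Y) V := by
    refine ops_le_ops (hunion ▸ Finset.subset_union_right) inf_le_left (fun j hj hj' => ?_) hP₂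
    exact hv₁ j ((Finset.mem_union.1 (hunion ▸ hj)).resolve_right hj')
  have key : T.sMap (denseFactor l N₁ Y₁ * denseFactor l N₂ Y₂) ∈ T.orbit (JX l Y) V := by
    refine mem_orbit.2 ⟨P₁ * P₂, mul_mem hP₁' hP₂', ?_⟩
    rw [hunion, Finset.prod_union hdisj, map_mul, Module.End.mul_apply,
      ops_xMap_mul hP₂ fun v hv => directional_prod_eq_zero hlh fun j hj => hv₁ j hj v hv, e₂,
      mul_comm, ops_sMap_mul hP₁, e₁, map_mul, mul_comm]
  refine ⟨max N₁ N₂, sMap_mem_orbit_of_dvd ?_ key⟩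
  refine (mul_dvd_mul (denseFactor_dvd (le_max_left N₁ N₂) le_rfl)
    (denseFactor_dvd (le_max_right N₁ N₂) le_rfl)).trans ?_
  unfold denseFactor
  rw [← Finset.prod_union]
  · refine prod_range_dvd_of_subset (fun Z hZ => ?_) le_rfl
    simp only [Finset.mem_union, Finset.mem_filter] at hZ ⊢
    exact hZ.elim (fun h => ⟨h.1, hlt₁.le.trans h.2⟩) fun h => ⟨h.1, hlt₂.le.trans h.2⟩
  · refine Finset.disjoint_left.2 fun Z hZ₁ hZ₂ => ?_
    rw [Finset.mem_filter] at hZ₁ hZ₂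
    obtain ⟨I, hI, rfl⟩ := Finset.mem_image.1 (Finset.mem_filter.1 hZ₁.1).1
    obtain ⟨i, hi⟩ := (Finset.mem_filter.1 hI).2
    exact hnot i (hZ₁.2.trans (iInf₂_le i hi)) (hZ₂.2.trans (iInf₂_le i hi))

/-- At every flat `Y`, the product of the factors of the dense flats containing `Y` satisfies a
functional equation with derivatives in the directions of any supplement of `Y`. -/
theorem exists_denseFactor_mem_orbit (hlh : ∀ i, (l i).IsHomogeneous 1) (hl0 : ∀ i, l i ≠ 0)
    (Y : Submodule ℂ (Fin n → ℂ)) (hY : ⨅ i ∈ JX l Y, hyp l i ≤ Y)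
    (V : Submodule ℂ (Fin n → ℂ)) (hV : V ⊔ Y = ⊤) :
    ∃ N, T.sMap (denseFactor l N Y) ∈ T.orbit (JX l Y) V := by
  classical
  induction Y using WellFoundedGT.induction generalizing V with
  | ind Y ih =>
    by_cases hirr : IrredOn l (JX l Y)
    · rcases (JX l Y).eq_empty_or_nonempty with hJ | hJ
      · refine ⟨0, mem_orbit.2 ⟨_, mulLeft_sMap_mem (denseFactor l 0 Y), ?_⟩⟩
        simp [hJ]
      · have hYL : Y ∈ Lprime l := Finset.mem_filter.2 ⟨Finset.mem_image.2
          ⟨JX l Y, by simpa using hJ, le_antisymm hY (le_iInf_JX Y)⟩, hirr⟩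
        refine exists_mem_orbit_of_irreducible hlh hYL hV fun S hS =>
          ih _ hS (iInf_JX_le_iInf S) V (top_le_iff.1 (hV ▸ sup_le_sup_left hS.le V))
    · exact exists_mem_orbit_of_reducible hlh hl0 hirr hV fun S hS V' hV' =>
        ih _ hS (iInf_JX_le_iInf S) V' hV'

end TwistedAction

section Localization

variable {n : ℕ} {ι : Type} [Fintype ι] {l : ι → MvPolynomial (Fin n) ℂ}

lemma pderiv_inl_rename_inr (i : Fin n) (g : MvPolynomial ι ℂ) :
    pderiv (Sum.inl i) (rename Sum.inr g : MvPolynomial (Fin n ⊕ ι) ℂ) = 0 := by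
  classical
  refine pderiv_eq_zero_of_notMem_vars fun h => ?_
  obtain ⟨j, -, hj⟩ := Finset.mem_image.1 (vars_rename Sum.inr g h)
  cases hj

open Classical in
/-- The twisted derivatives on `ℂ[x,s,1/F]` form a twisted action. -/
noncomputable def IsTwisted.twistedAction (hlh : ∀ i, (l i).IsHomogeneous 1)
    {D : Fin n → Module.End ℂ
      (Localization.Away (rename Sum.inl (∏ i, l i) : MvPolynomial (Fin n ⊕ ι) ℂ))}
    (hD : IsTwisted l D) :
    TwistedAction l
      (Localization.Away (rename Sum.inl (∏ i, l i) : MvPolynomial (Fin n ⊕ ι) ℂ)) where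
  xMap := (IsScalarTower.toAlgHom ℂ (MvPolynomial (Fin n ⊕ ι) ℂ) _).comp (rename Sum.inl)
  sMap := (IsScalarTower.toAlgHom ℂ (MvPolynomial (Fin n ⊕ ι) ℂ) _).comp (rename Sum.inr)
  inv j := algebraMap _ _ (rename Sum.inl (∏ k ∈ Finset.univ.erase j, l k) :
      MvPolynomial (Fin n ⊕ ι) ℂ) *
    IsLocalization.Away.invSelf (rename Sum.inl (∏ i, l i) : MvPolynomial (Fin n ⊕ ι) ℂ)
  D := D
  xMap_mul_inv j := by
    rw [AlgHom.comp_apply, IsScalarTower.coe_toAlgHom', ← mul_assoc, ← map_mul, ← map_mul,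
      Finset.mul_prod_erase _ _ (Finset.mem_univ j), IsLocalization.Away.mul_invSelf]
  D_xMap_mul i f m := by
    simp only [AlgHom.comp_apply, IsScalarTower.coe_toAlgHom', hD.1,
      pderiv_rename Sum.inl_injective]
  D_sMap_mul i g m := by
    simp only [AlgHom.comp_apply, IsScalarTower.coe_toAlgHom', hD.1, pderiv_inl_rename_inr,
      map_zero, zero_mul, zero_add]
  D_one i := by
    refine (IsLocalization.Away.algebraMap_isUnit
      (rename Sum.inl (∏ i, l i) : MvPolynomial (Fin n ⊕ ι) ℂ)).mul_left_cancel ?_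
    rw [hD.2, map_sum, Finset.mul_sum]
    refine Finset.sum_congr rfl fun j _ => ?_
    have h := IsLocalization.Away.mul_invSelf
      (S := Localization.Away (rename Sum.inl (∏ i, l i) : MvPolynomial (Fin n ⊕ ι) ℂ))
      (rename Sum.inl (∏ i, l i) : MvPolynomial (Fin n ⊕ ι) ℂ)
    rw [pderiv_eq_coeff (hlh j), toLin_single, ← smul_eq_C_mul, map_smul, mul_smul_comm,
      ← IsScalarTower.coe_toAlgHom' ℂ, map_smul, mul_smul_comm]
    congr 1
    simp only [AlgHom.comp_apply, IsScalarTower.coe_toAlgHom', rename_X, map_mul] at h ⊢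
    linear_combination (-(algebraMap (MvPolynomial (Fin n ⊕ ι) ℂ) (Localization.Away
      (rename Sum.inl (∏ i, l i) : MvPolynomial (Fin n ⊕ ι) ℂ)) (X (Sum.inr j)) *
        algebraMap _ _ (rename Sum.inl (∏ k ∈ Finset.univ.erase j, l k) :
          MvPolynomial (Fin n ⊕ ι) ℂ))) * h

lemma IsTwisted.ops_le_Wa (hlh : ∀ i, (l i).IsHomogeneous 1)
    {D : Fin n → Module.End ℂ
      (Localization.Away (rename Sum.inl (∏ i, l i) : MvPolynomial (Fin n ⊕ ι) ℂ))}
    (hD : IsTwisted l D) :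
    (hD.twistedAction hlh).ops Finset.univ ⊤ ≤ Wa l D := by
  have hx : ∀ r : MvPolynomial (Fin n ⊕ ι) ℂ, LinearMap.mulLeft ℂ (algebraMap _ (Localization.Away
      (rename Sum.inl (∏ i, l i) : MvPolynomial (Fin n ⊕ ι) ℂ)) r) ∈ Wa l D := by
    intro r
    induction r using MvPolynomial.induction_on with
    | C a =>
      convert Subalgebra.algebraMap_mem (Wa l D) a using 1
      refine LinearMap.ext fun m => ?_
      rw [LinearMap.mulLeft_apply, Module.algebraMap_end_apply, ← MvPolynomial.algebraMap_eq,
        ← IsScalarTower.algebraMap_apply, Algebra.smul_def]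
    | add f g hf hg =>
      convert add_mem hf hg using 1
      refine LinearMap.ext fun m => ?_
      simp [add_mul]
    | mul_X f i hf =>
      rw [map_mul, LinearMap.mulLeft_mul]
      refine mul_mem hf (Algebra.subset_adjoin (Or.inl ?_))
      rcases i with i | j
      · exact Or.inl ⟨i, rfl⟩
      · exact Or.inr ⟨j, rfl⟩
  refine Algebra.adjoin_le ?_
  rintro P ((⟨f, rfl⟩ | ⟨f, rfl⟩) | ⟨v, -, rfl⟩)
  · exact hx _
  · exact hx _
  · rw [TwistedAction.twist, sub_self, LinearMap.mulLeft_zero_eq_zero, add_zero]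
    have hDi : ∀ i, D i ∈ Wa l D := fun i => Algebra.subset_adjoin (Or.inr ⟨i, rfl⟩)
    exact sum_mem fun i _ => Subalgebra.smul_mem _ (hDi i) _

end Localization

end Arrangement

open Arrangement in
/-- For any central arrangement (not necessarily free) defined by
`l₁,…,l_p`, there is an `N` such that
`b_me = ∏_{X ∈ L'(A)} ∏_{j=0}^{N} ((∑_{i ∈ J(X)} sᵢ) + r(X) + j)` belongs to the
Bernstein ideal. -/
theorem exists_multiple_mem_bernstein_ideal
    (n p : ℕ) (hp : 1 ≤ p) (l : Fin p → MvPolynomial (Fin n) ℂ)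
    (hl0 : ∀ i, l i ≠ 0) (hlh : ∀ i, (l i).IsHomogeneous 1)
    (hprop : ∀ i j, i ≠ j → ∀ c : ℂ, l i ≠ c • l j)
    (D : Fin n → Module.End ℂ
      (Localization.Away (rename Sum.inl (∏ i, l i) : MvPolynomial (Fin n ⊕ Fin p) ℂ)))
    (hD : IsTwisted l D) :
    ∃ N : ℕ,
      (∏ Y ∈ Lprime l, ∏ j ∈ Finset.range (N + 1),
          ((∑ i ∈ JX l Y, X i) + C ((rX (n := n) Y : ℂ) + (j : ℂ)))) ∈ Bideal l D := by
  classical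
  set Y : Submodule ℂ (Fin n → ℂ) := ⨅ i ∈ Finset.univ, hyp l i with hY
  have hJ : JX l Y = Finset.univ := Finset.eq_univ_of_forall fun i =>
    subset_JX_iInf Finset.univ (Finset.mem_univ i)
  obtain ⟨N, hN⟩ := TwistedAction.exists_denseFactor_mem_orbit
    (T := hD.twistedAction hlh) hlh hl0 Y (iInf_JX_le_iInf Finset.univ) ⊤ (top_sup_eq _)
  rw [hJ] at hN
  obtain ⟨P, hP, e⟩ := TwistedAction.mem_orbit.1 hN
  refine ⟨N, P, hD.ops_le_Wa hlh hP, ?_⟩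
  have hf : denseFactor l N Y = ∏ Z ∈ Lprime l, ∏ j ∈ Finset.range (N + 1),
      ((∑ i ∈ JX l Z, X i) + C ((rX (n := n) Z : ℂ) + (j : ℂ))) := by
    rw [denseFactor, Finset.filter_true_of_mem]
    intro Z hZ
    obtain ⟨I, -, rfl⟩ := Finset.mem_image.1 (Finset.mem_filter.1 hZ).1
    exact biInf_mono (Finset.subset_univ I)
  rw [← hf]
  exact e.symm
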